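/- Let He_n denote the probabilists' Hermite polynomials, He_n(x) = (−1)^n e^{x²/2} (d/dx)^n e^{−x²/2}, and let γ denote the standard Gaussian measure on ℝ (density (2π)^{−1/2} e^{−x²/2}). Then for every ρ ∈ [−1, 1] and all k, n ∈ ℕ: ∫_ℝ ∫_ℝ He_k(x) · He_n(ρ·x + √(1−ρ²)·y) dγ(x) dγ(y) equals k! · ρ^k if k = n, and equals 0 if k ≠ n. -/

import Mathlib

open MeasureTheory ProbabilityTheory

open Polynomial in
theorem integrable_eval_gaussianReal (p : ℝ[X]) :
    Integrable (fun x ↦ p.eval x) (gaussianReal 0 1) := by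
  simp_rw [eval_eq_sum_range]
  refine integrable_finsetSum _ fun i _ ↦ Integrable.const_mul ?_ _
  have h := (memLp_id_gaussianReal (μ := 0) (v := 1) i).integrable_norm_pow'
  simp only [id, ← norm_pow] at h
  exact (integrable_norm_iff (by fun_prop)).1 h

open Polynomial in
theorem integrable_gaussianPDFReal_mul_eval (p : ℝ[X]) :
    Integrable (fun x ↦ gaussianPDFReal 0 1 x * p.eval x) := by
  have h := integrable_eval_gaussianReal p
  rw [gaussianReal_of_var_ne_zero _ one_ne_zero, integrable_withDensity_iff_integrable_smul'
    (measurable_gaussianPDF 0 1) (by simp [gaussianPDF])] at h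
  simpa [toReal_gaussianPDF] using h

theorem hasDerivAt_gaussianPDFReal_zero_one (x : ℝ) :
    HasDerivAt (gaussianPDFReal 0 1) (-x * gaussianPDFReal 0 1 x) x := by
  have h : HasDerivAt (fun x : ℝ ↦ -(x - 0) ^ 2 / (2 * ((1 : NNReal) : ℝ))) (-x) x := by
    convert! ((((hasDerivAt_id x).sub_const 0).pow 2).neg).div_const (2 * ((1 : NNReal) : ℝ)) using 1
    simp
    ring
  rw [gaussianPDFReal_def]
  convert! h.exp.const_mul _ using 1
  ring

open Polynomial in
/-- Gaussian integration by parts for polynomials. -/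
theorem integral_mul_eval_gaussianReal (p : ℝ[X]) :
    ∫ x, x * p.eval x ∂(gaussianReal 0 1) = ∫ x, (derivative p).eval x ∂(gaussianReal 0 1) := by
  rw [integral_gaussianReal_eq_integral_smul one_ne_zero,
    integral_gaussianReal_eq_integral_smul one_ne_zero, ← sub_eq_zero]
  have h₁ := integrable_gaussianPDFReal_mul_eval (X * p)
  have h₂ := integrable_gaussianPDFReal_mul_eval (derivative p)
  simp only [eval_mul, eval_X] at h₁
  simp only [smul_eq_mul]
  rw [← integral_sub h₁ h₂, ← neg_eq_zero, ← integral_neg]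
  refine integral_eq_zero_of_hasDerivAt_of_integrable (fun x ↦ ?_) (h₁.sub h₂).neg
    (integrable_gaussianPDFReal_mul_eval p)
  convert! (hasDerivAt_gaussianPDFReal_zero_one x).mul (p.hasDerivAt x) using 1
  ring

namespace Polynomial

theorem derivative_hermite_succ (n : ℕ) :
    derivative (hermite (n + 1)) = (n + 1 : ℤ[X]) * hermite n := by
  induction n with
  | zero => simp
  | succ n ih =>
    rw [hermite_succ (n + 1), derivative_sub, derivative_mul, derivative_X, ih, hermite_succ n]
    simp only [derivative_mul, derivative_add, derivative_natCast, derivative_one]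
    push_cast
    ring

/-- The probabilists' Hermite polynomials with real coefficients. -/
noncomputable def realHermite (n : ℕ) : ℝ[X] := (hermite n).map (algebraMap ℤ ℝ)

theorem eval_realHermite (n : ℕ) (x : ℝ) : (realHermite n).eval x = aeval x (hermite n) :=
  eval_map_algebraMap ..

theorem realHermite_zero : realHermite 0 = 1 := by simp [realHermite]

theorem realHermite_succ (n : ℕ) :
    realHermite (n + 1) = X * realHermite n - derivative (realHermite n) := by
  simp [realHermite, hermite_succ, derivative_map]

theorem derivative_realHermite_succ (n : ℕ) :
    derivative (realHermite (n + 1)) = (n + 1 : ℝ[X]) * realHermite n := by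
  rw [realHermite, derivative_map, derivative_hermite_succ]
  simp [realHermite]

theorem derivative_realHermite_zero : derivative (realHermite 0) = 0 := by
  simp [realHermite_zero]

theorem integral_realHermite_succ_mul (k : ℕ) (p : ℝ[X]) :
    ∫ x, (realHermite (k + 1)).eval x * p.eval x ∂(gaussianReal 0 1) =
      ∫ x, (realHermite k).eval x * (derivative p).eval x ∂(gaussianReal 0 1) := by
  have h := integral_mul_eval_gaussianReal (realHermite k * p)
  have h₁ := integrable_eval_gaussianReal (X * (realHermite k * p))
  have h₂ := integrable_eval_gaussianReal (derivative (realHermite k) * p)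
  have h₃ := integrable_eval_gaussianReal (realHermite k * derivative p)
  simp only [derivative_mul, eval_add, eval_mul, eval_X] at h h₁ h₂ h₃
  rw [integral_add h₂ h₃] at h
  simp only [realHermite_succ, eval_sub, eval_mul, eval_X, sub_mul, mul_assoc]
  rw [integral_sub h₁ h₂, h]
  ring

/-- Orthogonality of the Hermite polynomials under the standard Gaussian measure. -/
theorem integral_realHermite_mul_realHermite (k n : ℕ) :
    ∫ x, (realHermite k).eval x * (realHermite n).eval x ∂(gaussianReal 0 1) =
      if k = n then (k.factorial : ℝ) else 0 := by
  induction k generalizing n with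
  | zero =>
    cases n with
    | zero => simp [realHermite_zero]
    | succ n =>
      simp_rw [mul_comm (eval _ (realHermite 0)), integral_realHermite_succ_mul,
        derivative_realHermite_zero]
      simp
  | succ k ih =>
    rw [integral_realHermite_succ_mul]
    cases n with
    | zero => simp [derivative_realHermite_zero]
    | succ n =>
      simp only [derivative_realHermite_succ, eval_mul, mul_left_comm (eval _ (realHermite k))]
      have (x : ℝ) : eval x (n + 1 : ℝ[X]) = n + 1 := by simp
      simp_rw [this]
      rw [integral_const_mul, ih]
      by_cases h : k = n
      · simp [h, Nat.factorial_succ]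
      · simp [h]

theorem integral_realHermite_comp_succ (a s : ℝ) (n : ℕ) :
    ∫ y, (realHermite (n + 1)).eval (a + s * y) ∂(gaussianReal 0 1) =
      a * ∫ y, (realHermite n).eval (a + s * y) ∂(gaussianReal 0 1) -
        (1 - s ^ 2) *
          ∫ y, (derivative (realHermite n)).eval (a + s * y) ∂(gaussianReal 0 1) := by
  have h := integral_mul_eval_gaussianReal ((realHermite n).comp (C a + C s * X))
  have h₁ := integrable_eval_gaussianReal ((realHermite n).comp (C a + C s * X))
  have h₂ := integrable_eval_gaussianReal (X * (realHermite n).comp (C a + C s * X))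
  have h₃ := integrable_eval_gaussianReal ((derivative (realHermite n)).comp (C a + C s * X))
  simp only [derivative_comp, derivative_add, derivative_C, derivative_mul, derivative_X, zero_mul,
    zero_add, mul_one, eval_mul, eval_comp, eval_add, eval_C, eval_X, integral_const_mul]
    at h h₁ h₂ h₃
  simp only [realHermite_succ, eval_sub, eval_mul, eval_X, add_mul, mul_assoc]
  have h₄ : Integrable (fun y ↦ a * (realHermite n).eval (a + s * y) +
      s * (y * (realHermite n).eval (a + s * y))) (gaussianReal 0 1) :=
    (h₁.const_mul a).add (h₂.const_mul s)
  rw [integral_sub h₄ h₃,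
    integral_add (h₁.const_mul a) (h₂.const_mul s), integral_const_mul, integral_const_mul, h]
  ring

/-- The Ornstein–Uhlenbeck (Mehler) operator acts diagonally on Hermite polynomials. -/
theorem integral_realHermite_comp {ρ s : ℝ} (h : ρ ^ 2 + s ^ 2 = 1) (x : ℝ) (n : ℕ) :
    ∫ y, (realHermite n).eval (ρ * x + s * y) ∂(gaussianReal 0 1) =
      ρ ^ n * (realHermite n).eval x := by
  induction n using Nat.twoStepInduction with
  | zero => simp [realHermite_zero]
  | one =>
    rw [integral_realHermite_comp_succ, derivative_realHermite_zero]
    simp [realHermite_succ, realHermite_zero]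
  | more n ih ih' =>
    have hc (x : ℝ) : eval x (n + 1 : ℝ[X]) = n + 1 := by simp
    rw [integral_realHermite_comp_succ, ih', realHermite_succ (n + 1)]
    simp only [derivative_realHermite_succ, eval_mul, eval_sub, eval_X, hc, integral_const_mul, ih]
    rw [← eq_sub_iff_add_eq.2 h]
    ring

end Polynomial

/-- Orthogonality of probabilists' Hermite polynomials under correlated Gaussians
(Lemma 3.11): if `X = Z₁` and `Y = ρ Z₁ + √(1-ρ²) Z₂` with `Z₁, Z₂` i.i.d. standard
Gaussians, then `E[He_k(X) He_n(Y)] = k! ρ^k δ_{k,n}`. -/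
theorem stmt_4 (ρ : ℝ) (hρ : ρ ∈ Set.Icc (-1 : ℝ) 1) (k n : ℕ) :
    (∫ x : ℝ, ∫ y : ℝ,
        (Polynomial.aeval x (Polynomial.hermite k) : ℝ) *
          (Polynomial.aeval (ρ * x + Real.sqrt (1 - ρ ^ 2) * y) (Polynomial.hermite n) : ℝ)
        ∂(gaussianReal 0 1) ∂(gaussianReal 0 1))
      = if k = n then (Nat.factorial k : ℝ) * ρ ^ k else 0 := by
  have hs : ρ ^ 2 + Real.sqrt (1 - ρ ^ 2) ^ 2 = 1 := by
    rw [Real.sq_sqrt (by nlinarith [hρ.1, hρ.2])]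
    ring
  simp_rw [← Polynomial.eval_realHermite, integral_const_mul,
    Polynomial.integral_realHermite_comp hs, mul_left_comm _ (ρ ^ n)]
  rw [integral_const_mul, Polynomial.integral_realHermite_mul_realHermite]
  split_ifs with h
  · rw [h, mul_comm]
  · rw [mul_zero]
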